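/- If a configuration with counters (η, c) admits a stabilizing sequence, then every legal sequence for (η, c) can be extended, by appending further sites at its end, to a stabilizing sequence for (η, c). In particular, whatever choice of unstable site is made at each step, the stabilization procedure terminates. -/

import Mathlib

/-- `ν` is a possible toppling vector for site `v`: `v` loses grains, every other
site gains a nonnegative amount, and the total number of grains does not increase. -/
def IsTopplingVector {N : ℕ} (v : Fin N) (ν : Fin N → ℤ) : Prop :=
  ν v < 0 ∧ (∀ w, w ≠ v → 0 ≤ ν w) ∧ (∑ i, ν i) ≤ 0

/-- A deck assigns to each site an infinite sequence of toppling vectors (cards). -/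
def IsDeck {N : ℕ} (D : Fin N → ℕ → Fin N → ℤ) : Prop :=
  ∀ v i, IsTopplingVector v (D v i)

/-- The toppling operator `T_v` on configurations with counters:
apply the card `D v (c v)` and increment the counter at `v`. -/
def topple {N : ℕ} (D : Fin N → ℕ → Fin N → ℤ) (v : Fin N)
    (p : (Fin N → ℤ) × (Fin N → ℕ)) : (Fin N → ℤ) × (Fin N → ℕ) :=
  (p.1 + D v (p.2 v), p.2 + fun w => if w = v then 1 else 0)

/-- Apply the topplings of the sequence `s = (v_1, …, v_n)` in order,
i.e. `T_{v_n} ∘ ⋯ ∘ T_{v_1}`. -/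
def toppleList {N : ℕ} (D : Fin N → ℕ → Fin N → ℤ) (s : List (Fin N))
    (p : (Fin N → ℤ) × (Fin N → ℕ)) : (Fin N → ℤ) × (Fin N → ℕ) :=
  s.foldl (fun q v => topple D v q) p

/-- Site `v` is unstable in `η` (w.r.t. thresholds `M`) if `η v > M v`. -/
def Unstable {N : ℕ} (M : Fin N → ℤ) (η : Fin N → ℤ) (v : Fin N) : Prop :=
  M v < η v

/-- A configuration is stable if no site is unstable. -/
def Stable {N : ℕ} (M : Fin N → ℤ) (η : Fin N → ℤ) : Prop :=
  ∀ v, η v ≤ M v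

/-- `(v_1, …, v_n)` is legal for `(η, c)` if each `v_i` is unstable in the
configuration part of `(T_{v_{i-1}} ∘ ⋯ ∘ T_{v_1})(η, c)`. -/
def Legal {N : ℕ} (D : Fin N → ℕ → Fin N → ℤ) (M : Fin N → ℤ)
    (s : List (Fin N)) (p : (Fin N → ℤ) × (Fin N → ℕ)) : Prop :=
  ∀ i : Fin s.length, Unstable M (toppleList D (s.take i) p).1 (s.get i)

/-- A sequence is stabilizing for `(η, c)` if it is legal and the resulting
configuration is stable. -/
def Stabilizing {N : ℕ} (D : Fin N → ℕ → Fin N → ℤ) (M : Fin N → ℤ)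
    (s : List (Fin N)) (p : (Fin N → ℤ) × (Fin N → ℕ)) : Prop :=
  Legal D M s p ∧ Stable M (toppleList D s p).1

theorem legal_cons_iff {N : ℕ} {D : Fin N → ℕ → Fin N → ℤ} {M : Fin N → ℤ} {v : Fin N}
    {s : List (Fin N)} {p : (Fin N → ℤ) × (Fin N → ℕ)} :
    Legal D M (v :: s) p ↔ Unstable M p.1 v ∧ Legal D M s (topple D v p) := by
  constructor
  · exact fun h => ⟨h ⟨0, Nat.succ_pos _⟩, fun i => h i.succ⟩
  · rintro ⟨h0, h⟩ ⟨i, hi⟩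
    cases i with
    | zero => exact h0
    | succ i => exact h ⟨i, Nat.lt_of_succ_lt_succ hi⟩

theorem stabilizing_cons_iff {N : ℕ} {D : Fin N → ℕ → Fin N → ℤ} {M : Fin N → ℤ} {v : Fin N}
    {s : List (Fin N)} {p : (Fin N → ℤ) × (Fin N → ℕ)} :
    Stabilizing D M (v :: s) p ↔ Unstable M p.1 v ∧ Stabilizing D M s (topple D v p) := by
  unfold Stabilizing
  rw [legal_cons_iff, and_assoc]
  rfl

theorem topple_comm {N : ℕ} (D : Fin N → ℕ → Fin N → ℤ) {v w : Fin N} (h : w ≠ v)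
    (p : (Fin N → ℤ) × (Fin N → ℕ)) :
    topple D v (topple D w p) = topple D w (topple D v p) := by
  simp only [topple, Pi.add_apply, if_neg h, if_neg h.symm, add_zero]
  rw [add_right_comm p.1, add_right_comm p.2]

theorem Unstable.topple {N : ℕ} {D : Fin N → ℕ → Fin N → ℤ} (hD : IsDeck D) {M : Fin N → ℤ}
    {v w : Fin N} (h : v ≠ w) {p : (Fin N → ℤ) × (Fin N → ℕ)} (hv : Unstable M p.1 v) :
    Unstable M (topple D w p).1 v :=
  lt_of_lt_of_le hv (le_add_of_nonneg_right ((hD w (p.2 w)).2.1 v h))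

/-- Toppling an unstable site of a stabilizable configuration leaves it stabilizable. -/
theorem Stabilizing.exists_topple {N : ℕ} {D : Fin N → ℕ → Fin N → ℤ} (hD : IsDeck D)
    {M : Fin N → ℤ} {v : Fin N} {s : List (Fin N)} {p : (Fin N → ℤ) × (Fin N → ℕ)}
    (hs : Stabilizing D M s p) (hv : Unstable M p.1 v) :
    ∃ u, Stabilizing D M u (topple D v p) := by
  induction s generalizing p with
  | nil => exact absurd hv (not_lt_of_ge (hs.2 v))
  | cons w s ih =>
    obtain ⟨hw, hs⟩ := stabilizing_cons_iff.1 hs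
    by_cases h : w = v
    · subst h
      exact ⟨s, hs⟩
    · obtain ⟨u, hu⟩ := ih hs (hv.topple hD (Ne.symm h))
      rw [topple_comm D h] at hu
      exact ⟨w :: u, stabilizing_cons_iff.2 ⟨hw.topple hD h, hu⟩⟩

/-- If `(η, c)` admits a stabilizing sequence, then every legal sequence for
`(η, c)` can be extended (by appending sites) to a stabilizing sequence. -/
theorem legal_extends_to_stabilizing {N : ℕ} (D : Fin N → ℕ → Fin N → ℤ) (hD : IsDeck D)
    (M : Fin N → ℤ) (η : Fin N → ℤ) (c : Fin N → ℕ)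
    (s : List (Fin N)) (hs : Stabilizing D M s (η, c))
    (t : List (Fin N)) (ht : Legal D M t (η, c)) :
    ∃ u : List (Fin N), Stabilizing D M (t ++ u) (η, c) := by
  generalize (η, c) = p at hs ht
  induction t generalizing p s with
  | nil => exact ⟨s, hs⟩
  | cons v t ih =>
    obtain ⟨hv, ht⟩ := legal_cons_iff.1 ht
    obtain ⟨r, hr⟩ := hs.exists_topple hD hv
    obtain ⟨u, hu⟩ := ih r (topple D v p) hr ht
    exact ⟨u, stabilizing_cons_iff.2 ⟨hv, hu⟩⟩
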